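/- arXiv:1405.4663 — 2 statements merged into one kernel-verified Lean document; each statement's English description precedes it below -/
import Mathlib

section
/- Let p be a prime number and let f be a polynomial map of degree d ≥ 2 over ℂ_p. Suppose f is immediately expanding, i.e. the Julia set J(f) is non-empty and there exists λ > 1 such that |f'(z)| ≥ λ for all z ∈ J(f). Then f is J-stable in Poly_d(ℂ_p): there exists ε > 0 such that for every polynomial g(z) = b_d z^d + ⋯ + b_0 over ℂ_p with b_d ≠ 0 and |a_k − b_k| < ε for all 0 ≤ k ≤ d (where f(z) = a_d z^d + ⋯ + a_0), there exists a homeomorphism h : J(f) → J(g) with h(f(z)) = g(h(z)) for all z ∈ J(f). -/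
open Polynomial

noncomputable section

/-- The projective line over `K`: `K` together with a point at infinity (`none`). -/
def P1 (K : Type*) := Option K

variable {K : Type*}

/-- Inclusion of `K` into the projective line. -/
def toP1 : K → P1 K := some

/-- The point at infinity of the projective line. -/
def P1.infty : P1 K := none

/-- The extension of a polynomial map to the projective line, sending `∞` to `∞`. -/
def polyMap [CommRing K] (f : K[X]) : P1 K → P1 K :=
  fun z => Option.map (fun w => f.eval w) z

/-- The chordal metric on the projective line over a normed field. -/
def chordal [NormedField K] (x y : P1 K) : ℝ :=
  match x, y with
  | some z, some w => ‖z - w‖ / (max ‖z‖ 1 * max ‖w‖ 1)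
  | some z, none => 1 / max ‖z‖ 1
  | none, some w => 1 / max ‖w‖ 1
  | none, none => 0

/-- A subset of the projective line is `ρ`-open if around each of its points it contains a
ball with respect to the chordal metric. -/
def IsRhoOpen [NormedField K] (U : Set (P1 K)) : Prop :=
  ∀ x ∈ U, ∃ ε > 0, ∀ y, chordal x y < ε → y ∈ U

/-- The topology on the projective line induced by the chordal metric. -/
instance P1.instTopologicalSpace (K : Type*) [NormedField K] : TopologicalSpace (P1 K) where
  IsOpen := IsRhoOpen
  isOpen_univ := fun _ _ => ⟨1, one_pos, fun _ _ => trivial⟩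
  isOpen_inter := fun U V hU hV x hx => by
    obtain ⟨ε₁, hε₁, h₁⟩ := hU x hx.1
    obtain ⟨ε₂, hε₂, h₂⟩ := hV x hx.2
    exact ⟨min ε₁ ε₂, lt_min hε₁ hε₂, fun y hy =>
      ⟨h₁ y (lt_of_lt_of_le hy (min_le_left _ _)), h₂ y (lt_of_lt_of_le hy (min_le_right _ _))⟩⟩
  isOpen_sUnion := fun S hS x hx => by
    obtain ⟨U, hUS, hxU⟩ := hx
    obtain ⟨ε, hε, h⟩ := hS U hUS x hxU
    exact ⟨ε, hε, fun y hy => ⟨U, hUS, h y hy⟩⟩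

/-- The Fatou set of a polynomial map: the largest `ρ`-open subset of the projective line on
which the family of iterates is equicontinuous with respect to the chordal metric. -/
def fatou [NormedField K] (f : K[X]) : Set (P1 K) :=
  {x | ∃ U : Set (P1 K), x ∈ U ∧ IsRhoOpen U ∧
    ∀ y ∈ U, ∀ ε > 0, ∃ δ > 0, ∀ z : P1 K, chordal y z < δ →
      ∀ n : ℕ, chordal ((polyMap f)^[n] y) ((polyMap f)^[n] z) < ε}

/-- The Julia set of a polynomial map: the complement of the Fatou set. -/
def julia [NormedField K] (f : K[X]) : Set (P1 K) :=
  (fatou f)ᶜ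

/-- The dynamics of `f` and `g` on their Julia sets are conjugate: there is a homeomorphism
`h : J(f) → J(g)` with `h ∘ f = g ∘ h` on `J(f)`. -/
def JuliaConjugate [NormedField K] (f g : K[X]) : Prop :=
  ∃ h : (julia f) ≃ₜ (julia g),
    ∀ (z : P1 K) (hz : z ∈ julia f), ∃ hfz : polyMap f z ∈ julia f,
      (h ⟨polyMap f z, hfz⟩ : P1 K) = polyMap g (h ⟨z, hz⟩)

/-- `min {|l|^{1/(l-1)} : 2 ≤ l ≤ d}` where `|l|` is the `p`-adic absolute value of `l`. -/
def muFactor (p : ℕ) [Fact (Nat.Prime p)] (d : ℕ) : ℝ :=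
  sInf {x : ℝ | ∃ l : ℕ, 2 ≤ l ∧ l ≤ d ∧ x = ‖(l : ℚ_[p])‖ ^ ((1 : ℝ) / ((l : ℝ) - 1))}

lemma eval_eq_eval_taylor [CommRing K] (P : K[X]) (z u : K) :
    P.eval u = (taylor z P).eval (u - z) := by
  rw [taylor_eval, sub_add_cancel]

section Ultrametric

variable [NormedField K] [IsUltrametricDist K]

lemma norm_sub_le_max_norm (a b : K) : ‖a - b‖ ≤ max ‖a‖ ‖b‖ := by
  simpa [sub_eq_add_neg] using IsUltrametricDist.norm_add_le_max a (-b)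

lemma norm_sub_le_of_norm_sub_le {a b c : K} {s : ℝ} (h₁ : ‖a - b‖ ≤ s) (h₂ : ‖b - c‖ ≤ s) :
    ‖a - c‖ ≤ s := by
  have := IsUltrametricDist.norm_add_le_max (a - b) (b - c)
  rw [sub_add_sub_cancel] at this
  exact this.trans (max_le h₁ h₂)

lemma norm_eq_of_norm_sub_lt {a b : K} (h : ‖a - b‖ < ‖b‖) : ‖a‖ = ‖b‖ := by
  have := IsUltrametricDist.norm_add_eq_max_of_norm_ne_norm h.ne
  rw [sub_add_cancel] at this
  rw [this, max_eq_right h.le]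

lemma norm_le_of_norm_sub_le {a b : K} {R : ℝ} (h : ‖a - b‖ ≤ R) (hb : ‖b‖ ≤ R) : ‖a‖ ≤ R := by
  simpa using norm_sub_le_of_norm_sub_le h (show ‖b - 0‖ ≤ R by simpa using hb)

/-- A polynomial without zeros in the closed disc of radius `ρ` has a dominant constant term
there. -/
lemma coeff_mul_pow_lt_of_forall_eval_ne_zero [IsAlgClosed K] {ρ : ℝ} (hρ : 0 ≤ ρ) :
    ∀ (P : K[X]), (∀ h : K, ‖h‖ ≤ ρ → P.eval h ≠ 0) →
      ∀ k, 1 ≤ k → ‖P.coeff k‖ * ρ ^ k < ‖P.coeff 0‖ := by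
  intro P
  induction hn : P.natDegree generalizing P with
  | zero =>
    intro hP k hk
    have h0 : P.coeff 0 ≠ 0 := by
      rw [coeff_zero_eq_eval_zero]; exact hP 0 (by simpa using hρ)
    rw [coeff_eq_zero_of_natDegree_lt (by omega)]
    simpa using h0
  | succ n ih =>
    intro hP k hk
    obtain ⟨a, ha⟩ := IsAlgClosed.exists_root P (by
      rw [degree_eq_natDegree (by rintro rfl; simp at hn), hn]; norm_cast)
    obtain ⟨Q, rfl⟩ := dvd_iff_isRoot.2 ha
    have hQ : Q ≠ 0 := by rintro rfl; simp at hn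
    have hQn : Q.natDegree = n := by
      rw [natDegree_mul (X_sub_C_ne_zero a) hQ, natDegree_X_sub_C] at hn; omega
    have haρ : ρ < ‖a‖ := by
      by_contra h
      exact hP a (not_lt.1 h) (by simp)
    have hQ' := ih Q hQn (fun h hh h0 => hP h hh (by simp [h0]))
    have hQ0 : 0 < ‖Q.coeff 0‖ := by
      have h0 : Q.coeff 0 ≠ 0 := by
        rw [coeff_zero_eq_eval_zero]
        intro h0
        exact hP 0 (by simpa using hρ) (by simp [h0])
      simpa using h0
    obtain ⟨m, rfl⟩ : ∃ m, k = m + 1 := ⟨k - 1, by omega⟩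
    have e0 : ((X - C a) * Q).coeff 0 = -(a * Q.coeff 0) := by simp [mul_coeff_zero]
    have e1 : ((X - C a) * Q).coeff (m + 1) = Q.coeff m - a * Q.coeff (m + 1) := by
      rw [sub_mul, coeff_sub, coeff_X_mul, coeff_C_mul]
    have hρm : 0 ≤ ρ ^ (m + 1) := by positivity
    have hm : ‖Q.coeff m‖ * ρ ^ m ≤ ‖Q.coeff 0‖ := by
      rcases Nat.eq_zero_or_pos m with rfl | hm
      · simp
      · exact (hQ' m hm).le
    rw [e0, e1, norm_neg, norm_mul]
    have h1 : ‖Q.coeff m‖ * ρ ^ (m + 1) < ‖a‖ * ‖Q.coeff 0‖ := by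
      calc ‖Q.coeff m‖ * ρ ^ (m + 1) = ρ * (‖Q.coeff m‖ * ρ ^ m) := by ring
        _ ≤ ρ * ‖Q.coeff 0‖ := by gcongr
        _ < ‖a‖ * ‖Q.coeff 0‖ := by gcongr
    have h2 : ‖a * Q.coeff (m + 1)‖ * ρ ^ (m + 1) < ‖a‖ * ‖Q.coeff 0‖ := by
      rw [norm_mul, mul_assoc]
      have := hQ' (m + 1) (by omega)
      have : 0 < ‖a‖ := hρ.trans_lt haρ
      gcongr
    refine (mul_le_mul_of_nonneg_right (norm_sub_le_max_norm _ _) hρm).trans_lt ?_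
    rw [max_mul_of_nonneg _ _ hρm]
    exact max_lt h1 h2

/-- If `P` omits the value `v` on the closed disc of radius `ρ` about `z`, then the Taylor
coefficients of `P` at `z` are controlled by `P z - v`. -/
lemma coeff_taylor_mul_pow_lt [IsAlgClosed K] (P : K[X]) (z v : K) {ρ : ℝ} (hρ : 0 ≤ ρ)
    (h : ∀ u : K, ‖u - z‖ ≤ ρ → P.eval u ≠ v) {k : ℕ} (hk : 1 ≤ k) :
    ‖(taylor z P).coeff k‖ * ρ ^ k < ‖P.eval z - v‖ := by
  have := coeff_mul_pow_lt_of_forall_eval_ne_zero hρ (taylor z P - C v) (fun t ht h0 => by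
    refine h (t + z) (by simpa using ht) ?_
    rw [eval_sub, eval_C, taylor_eval] at h0
    exact sub_eq_zero.1 h0) k hk
  rwa [coeff_sub, coeff_sub, coeff_C_zero, taylor_coeff_zero, coeff_C_of_ne_zero (by omega),
    sub_zero] at this

lemma exists_eval_eq [IsAlgClosed K] (P : K[X]) (z v : K) {ρ : ℝ} (hρ : 0 ≤ ρ)
    {k : ℕ} (hk : 1 ≤ k) (h : ‖P.eval z - v‖ ≤ ‖(taylor z P).coeff k‖ * ρ ^ k) :
    ∃ u : K, ‖u - z‖ ≤ ρ ∧ P.eval u = v := by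
  by_contra! hc
  exact absurd h (not_le.2 (coeff_taylor_mul_pow_lt P z v hρ hc hk))

lemma exists_eval_eq_of_derivative [IsAlgClosed K] (P : K[X]) (z v : K) {ρ : ℝ} (hρ : 0 ≤ ρ)
    (h : ‖P.eval z - v‖ ≤ ‖(derivative P).eval z‖ * ρ) :
    ∃ u : K, ‖u - z‖ ≤ ρ ∧ P.eval u = v :=
  exists_eval_eq P z v hρ le_rfl (by rwa [taylor_coeff_one, pow_one])

lemma exists_eval_eq_of_leadingCoeff [IsAlgClosed K] (P : K[X]) (z v : K) {ρ : ℝ} (hρ : 0 ≤ ρ)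
    (hP : 1 ≤ P.natDegree) (h : ‖P.eval z - v‖ ≤ ‖P.leadingCoeff‖ * ρ ^ P.natDegree) :
    ∃ u : K, ‖u - z‖ ≤ ρ ∧ P.eval u = v :=
  exists_eval_eq P z v hρ hP (by rwa [coeff_taylor_natDegree])

/-- A non-archimedean Schwarz lemma for polynomials omitting a value on a disc. -/
lemma norm_eval_sub_eval_le [IsAlgClosed K] (P : K[X]) (z v : K) {r : ℝ} (hr : 0 < r)
    (h : ∀ u : K, ‖u - z‖ ≤ r → P.eval u ≠ v) {u : K} (hu : ‖u - z‖ ≤ r) :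
    ‖P.eval u - P.eval z‖ ≤ ‖P.eval z - v‖ / r * ‖u - z‖ := by
  rw [eval_eq_eval_taylor P z u, eval_eq_sum_range, Finset.sum_range_succ', pow_zero, mul_one,
    taylor_coeff_zero, add_sub_cancel_right]
  refine IsUltrametricDist.norm_sum_le_of_forall_le_of_nonneg (by positivity) fun k _ => ?_
  have hk := (coeff_taylor_mul_pow_lt P z v hr.le h (Nat.le_add_left 1 k)).le
  rw [norm_mul, norm_pow]
  calc ‖(taylor z P).coeff (k + 1)‖ * ‖u - z‖ ^ (k + 1)
      = ‖(taylor z P).coeff (k + 1)‖ * ‖u - z‖ ^ k * ‖u - z‖ := by ring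
    _ ≤ ‖(taylor z P).coeff (k + 1)‖ * r ^ k * ‖u - z‖ := by gcongr
    _ = ‖(taylor z P).coeff (k + 1)‖ * r ^ (k + 1) / r * ‖u - z‖ := by
        field_simp
        ring
    _ ≤ ‖P.eval z - v‖ / r * ‖u - z‖ := by gcongr

lemma norm_eval_le {P : K[X]} {d : ℕ} {B R : ℝ} (hB : 0 ≤ B) (hR : 1 ≤ R)
    (hd : P.natDegree ≤ d) (hP : ∀ k, ‖P.coeff k‖ ≤ B) {z : K} (hz : ‖z‖ ≤ R) :
    ‖P.eval z‖ ≤ B * R ^ d := by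
  rw [eval_eq_sum_range' (Nat.lt_succ_of_le hd)]
  refine IsUltrametricDist.norm_sum_le_of_forall_le_of_nonneg (by positivity) fun k hk => ?_
  rw [norm_mul, norm_pow]
  have : k ≤ d := by simpa [Nat.lt_succ_iff] using hk
  calc ‖P.coeff k‖ * ‖z‖ ^ k ≤ B * R ^ k := by gcongr; exact hP k
    _ ≤ B * R ^ d := by gcongr

lemma norm_coeff_hasseDeriv_le {P : K[X]} {B : ℝ} (hP : ∀ k, ‖P.coeff k‖ ≤ B) (j k : ℕ) :
    ‖(hasseDeriv j P).coeff k‖ ≤ B := by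
  rw [hasseDeriv_coeff, norm_mul]
  have h1 := IsUltrametricDist.norm_natCast_le_one K ((k + j).choose j)
  exact (mul_le_of_le_one_left (norm_nonneg _) h1).trans (hP _)

lemma norm_coeff_derivative_le {P : K[X]} {B : ℝ} (hP : ∀ k, ‖P.coeff k‖ ≤ B) (k : ℕ) :
    ‖(derivative P).coeff k‖ ≤ B := by
  rw [← hasseDeriv_one]
  exact norm_coeff_hasseDeriv_le hP 1 k

lemma norm_coeff_taylor_le {P : K[X]} {d : ℕ} {B R : ℝ} (hB : 0 ≤ B) (hR : 1 ≤ R)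
    (hd : P.natDegree ≤ d) (hP : ∀ k, ‖P.coeff k‖ ≤ B) {z : K} (hz : ‖z‖ ≤ R) (k : ℕ) :
    ‖(taylor z P).coeff k‖ ≤ B * R ^ d := by
  rw [taylor_coeff]
  exact norm_eval_le hB hR ((natDegree_hasseDeriv_le P k).trans (by omega))
    (norm_coeff_hasseDeriv_le hP k) hz

lemma norm_eval_sub_eval_le_of_coeff {P : K[X]} {z u : K} {M : ℝ} (hM : 0 ≤ M)
    (h : ∀ k, ‖(taylor z P).coeff k‖ ≤ M) (hu : ‖u - z‖ ≤ 1) :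
    ‖P.eval u - P.eval z‖ ≤ M * ‖u - z‖ := by
  rw [eval_eq_eval_taylor P z u, eval_eq_sum_range, Finset.sum_range_succ', pow_zero, mul_one,
    taylor_coeff_zero, add_sub_cancel_right]
  refine IsUltrametricDist.norm_sum_le_of_forall_le_of_nonneg (by positivity) fun k _ => ?_
  rw [norm_mul, norm_pow]
  gcongr
  · exact h _
  · exact pow_le_of_le_one (norm_nonneg _) hu (by omega)

lemma norm_eval_sub_linear_le_of_coeff {P : K[X]} {z u : K} {M : ℝ} (hM : 0 ≤ M)
    (h : ∀ k, ‖(taylor z P).coeff k‖ ≤ M) (hu : ‖u - z‖ ≤ 1) :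
    ‖P.eval u - P.eval z - (derivative P).eval z * (u - z)‖ ≤ M * ‖u - z‖ ^ 2 := by
  have hlt : (taylor z P).natDegree < (taylor z P).natDegree + 1 + 1 := by omega
  rw [eval_eq_eval_taylor P z u, eval_eq_sum_range' hlt, Finset.sum_range_succ',
    Finset.sum_range_succ', pow_zero, mul_one,
    taylor_coeff_zero, add_sub_cancel_right, zero_add, taylor_coeff_one, pow_one,
    add_sub_cancel_right]
  refine IsUltrametricDist.norm_sum_le_of_forall_le_of_nonneg (by positivity) fun k _ => ?_
  rw [norm_mul, norm_pow]
  have := h (k + 1 + 1)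
  have : ‖u - z‖ ^ (k + 1 + 1) ≤ ‖u - z‖ ^ 2 :=
    pow_le_pow_of_le_one (norm_nonneg _) hu (by omega)
  gcongr

/-- Near a point where the derivative has norm larger than one, a polynomial scales distances
by the norm of its derivative. -/
lemma norm_eval_sub_eval_eq {P : K[X]} {d : ℕ} {B R r : ℝ} (hB : 0 ≤ B) (hR : 1 ≤ R)
    (hr : r ≤ 1) (hBr : B * R ^ d * r ≤ 1)
    (hd : P.natDegree ≤ d) (hP : ∀ k, ‖P.coeff k‖ ≤ B) {z u v : K} (hz : ‖z‖ ≤ R)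
    (hPz : 1 < ‖(derivative P).eval z‖) (hu : ‖u - z‖ ≤ r) (hv : ‖v - z‖ ≤ r) :
    ‖(derivative P).eval v‖ = ‖(derivative P).eval z‖ ∧
      ‖P.eval u - P.eval v‖ = ‖(derivative P).eval z‖ * ‖u - v‖ := by
  have hM : 0 ≤ B * R ^ d := by positivity
  have h1 : ‖(derivative P).eval v‖ = ‖(derivative P).eval z‖ := by
    apply norm_eq_of_norm_sub_lt
    refine lt_of_le_of_lt ?_ hPz
    refine (norm_eval_sub_eval_le_of_coeff hM (norm_coeff_taylor_le hB hR
      ((natDegree_derivative_le P).trans (by omega)) (norm_coeff_derivative_le hP) hz)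
      (hv.trans hr)).trans (le_trans ?_ hBr)
    gcongr
  refine ⟨h1, ?_⟩
  have huv : ‖u - v‖ ≤ r := norm_sub_le_of_norm_sub_le hu (by rwa [norm_sub_rev])
  have hvR : ‖v‖ ≤ R := norm_le_of_norm_sub_le (hv.trans (hr.trans hR)) hz
  rcases eq_or_ne u v with rfl | hne
  · simp
  have hpos : 0 < ‖u - v‖ := norm_pos_iff.2 (sub_ne_zero.2 hne)
  rw [← h1, ← norm_mul]
  apply norm_eq_of_norm_sub_lt
  refine (norm_eval_sub_linear_le_of_coeff hM (norm_coeff_taylor_le hB hR hd hP hvR)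
    (huv.trans hr)).trans_lt ?_
  rw [norm_mul, h1]
  calc B * R ^ d * ‖u - v‖ ^ 2 = B * R ^ d * ‖u - v‖ * ‖u - v‖ := by ring
    _ ≤ B * R ^ d * r * ‖u - v‖ := by gcongr
    _ ≤ 1 * ‖u - v‖ := by gcongr
    _ < _ := by gcongr

end Ultrametric

section Julia

variable [NormedField K]

/-- `R` is an escape radius of `f`: outside the closed disc of radius `R`, `f` at least doubles
the norm. -/
def IsEscapeRadius (f : K[X]) (R : ℝ) : Prop :=
  1 ≤ R ∧ ∀ z : K, R < ‖z‖ → 2 * ‖z‖ ≤ ‖f.eval z‖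

/-- The map `K → K` defined by a polynomial. -/
abbrev evalMap (f : K[X]) : K → K := fun z => f.eval z

/-- The boundary of the filled Julia set, described through an escape radius. -/
def boundaryFilledJulia (f : K[X]) (R : ℝ) : Set K :=
  {w | (∀ n, ‖(evalMap f)^[n] w‖ ≤ R) ∧
    ∀ r > 0, ∃ u, ‖u - w‖ ≤ r ∧ ∃ n, R < ‖(evalMap f)^[n] u‖}

lemma iterate_evalMap_eq_eval (f : K[X]) (n : ℕ) (z : K) :
    (evalMap f)^[n] z = (f.comp^[n] X).eval z := by
  rw [iterate_comp_eval, eval_X]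

lemma continuous_iterate_evalMap (f : K[X]) (n : ℕ) : Continuous (evalMap f)^[n] := by
  have : Continuous (evalMap f) := f.continuous
  exact this.iterate n

lemma polyMap_iterate_toP1 (f : K[X]) (n : ℕ) (z : K) :
    (polyMap f)^[n] (toP1 z) = toP1 ((evalMap f)^[n] z) := by
  induction n generalizing z with
  | zero => rfl
  | succ n ih => exact ih (f.eval z)

lemma polyMap_iterate_infty (f : K[X]) (n : ℕ) :
    (polyMap f)^[n] P1.infty = P1.infty :=
  Function.iterate_fixed rfl n

lemma chordal_toP1 (z w : K) :
    chordal (toP1 z) (toP1 w) = ‖z - w‖ / (max ‖z‖ 1 * max ‖w‖ 1) := rfl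

lemma chordal_infty_toP1 (w : K) : chordal P1.infty (toP1 w) = 1 / max ‖w‖ 1 := rfl

lemma chordal_toP1_infty (w : K) : chordal (toP1 w) P1.infty = 1 / max ‖w‖ 1 := rfl

lemma chordal_infty_infty : chordal (P1.infty : P1 K) P1.infty = 0 := rfl

lemma chordal_toP1_le (z w : K) : chordal (toP1 z) (toP1 w) ≤ ‖w - z‖ / max ‖z‖ 1 := by
  rw [chordal_toP1, norm_sub_rev]
  gcongr
  exact le_mul_of_one_le_right (by positivity) (le_max_right _ _)

lemma chordal_toP1_le_norm (z w : K) : chordal (toP1 z) (toP1 w) ≤ ‖w - z‖ :=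
  (chordal_toP1_le z w).trans (div_le_self (norm_nonneg _) (le_max_right _ _))

/-- Points that are chordally close to a finite point are close in the affine line. -/
lemma exists_chordal_lt_imp (z : K) {ε : ℝ} (hε : 0 < ε) :
    ∃ δ > 0, ∀ y : P1 K, chordal (toP1 z) y < δ → ∃ w, y = toP1 w ∧ ‖w - z‖ < ε := by
  set A := max ‖z‖ 1 with hA
  have hA1 : 1 ≤ A := le_max_right _ _
  have hzA : ‖z‖ ≤ A := le_max_left _ _
  have hA0 : 0 < A := by linarith
  refine ⟨min (1 / (2 * A)) (ε / (A * (A + ε + 1) * 2)), by positivity, fun y hy => ?_⟩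
  have hy1 := hy.trans_le (min_le_left _ _)
  have hy2 := hy.trans_le (min_le_right _ _)
  rcases y with _ | w
  · exfalso
    change 1 / A < _ at hy1
    rw [div_lt_div_iff₀ hA0 (by positivity)] at hy1
    linarith
  · refine ⟨w, rfl, ?_⟩
    change ‖z - w‖ / (A * max ‖w‖ 1) < _ at hy1 hy2
    set B := max ‖w‖ 1 with hB
    have hB1 : 1 ≤ B := le_max_right _ _
    have hB0 : 0 < B := by linarith
    have htri : ‖w‖ ≤ ‖z‖ + ‖z - w‖ := by
      have := norm_sub_le z (z - w); rwa [sub_sub_cancel] at this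
    have hBle : B ≤ A + ‖z - w‖ := by
      refine max_le (by linarith) (by linarith [norm_nonneg (z - w)])
    rw [norm_sub_rev w z]
    set t := ‖z - w‖
    have ht : 0 ≤ t := norm_nonneg _
    rw [div_lt_div_iff₀ (by positivity) (by positivity)] at hy1 hy2
    have h1 : t < A := by nlinarith
    have h2 : t * ((A + ε + 1) * 2) < ε * B := by
      have : A * (t * ((A + ε + 1) * 2)) < A * (ε * B) := by nlinarith
      exact lt_of_mul_lt_mul_left this hA0.le
    nlinarith

lemma isOpenEmbedding_toP1 : Topology.IsOpenEmbedding (toP1 : K → P1 K) := by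
  refine Topology.IsOpenEmbedding.of_continuous_injective_isOpenMap ?_ ?_ ?_
  · refine continuous_def.2 fun U hU => Metric.isOpen_iff.2 fun z hz => ?_
    obtain ⟨ε, hε, h⟩ := hU (toP1 z) hz
    refine ⟨ε, hε, fun w hw => h _ ((chordal_toP1_le_norm z w).trans_lt ?_)⟩
    rwa [Metric.mem_ball, dist_eq_norm] at hw
  · exact Option.some_injective K
  · rintro U hU _ ⟨z, hz, rfl⟩
    obtain ⟨ε, hε, h⟩ := Metric.isOpen_iff.1 hU z hz
    obtain ⟨δ, hδ, h'⟩ := exists_chordal_lt_imp z hε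
    refine ⟨δ, hδ, fun y hy => ?_⟩
    obtain ⟨w, rfl, hw⟩ := h' y hy
    exact ⟨w, h (by rwa [Metric.mem_ball, dist_eq_norm]), rfl⟩

lemma isRhoOpen_image_toP1 {U : Set K} (hU : IsOpen U) : IsRhoOpen (toP1 '' U) :=
  isOpenEmbedding_toP1.isOpenMap U hU

namespace IsEscapeRadius

variable {f : K[X]} {R : ℝ}

lemma norm_le_norm_iterate (hf : IsEscapeRadius f R) {z : K} (hz : R < ‖z‖) (n : ℕ) :
    ‖z‖ ≤ ‖(evalMap f)^[n] z‖ := by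
  induction n with
  | zero => simp
  | succ n ih =>
    rw [Function.iterate_succ_apply']
    have := hf.2 _ (hz.trans_le ih)
    have := norm_nonneg ((evalMap f)^[n] z)
    change _ ≤ ‖f.eval _‖
    linarith

lemma norm_le_of_norm_eval_le (hf : IsEscapeRadius f R) {z : K} (hz : ‖f.eval z‖ ≤ R) :
    ‖z‖ ≤ R := by
  by_contra! h
  have := hf.2 z h
  linarith [norm_nonneg z]

lemma lt_norm_iterate_of_le (hf : IsEscapeRadius f R) {z : K} {m n : ℕ} (hmn : m ≤ n)
    (hz : R < ‖(evalMap f)^[m] z‖) : R < ‖(evalMap f)^[n] z‖ := by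
  obtain ⟨k, rfl⟩ := Nat.exists_eq_add_of_le hmn
  rw [add_comm, Function.iterate_add_apply]
  exact hz.trans_le (hf.norm_le_norm_iterate hz k)

end IsEscapeRadius

lemma exists_eval_eq_self [IsAlgClosed K] {f : K[X]} (hf : 2 ≤ f.natDegree) :
    ∃ x : K, f.eval x = x := by
  have hdeg : (f - X).natDegree = f.natDegree :=
    natDegree_sub_eq_left_of_natDegree_lt (by rw [natDegree_X]; omega)
  obtain ⟨x, hx⟩ := IsAlgClosed.exists_root (f - X) (fun h => by
    rw [natDegree_eq_of_degree_eq_some (n := 0) h] at hdeg; omega)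
  exact ⟨x, by simpa [sub_eq_zero] using hx⟩

variable [IsUltrametricDist K] [IsAlgClosed K]

/-- A finite point with a disc neighbourhood on which all iterates omit a common value is
a point of equicontinuity. -/
lemma exists_forall_chordal_iterate_lt {f : K[X]} {y v : K} {r : ℝ} (hr : 0 < r)
    (h : ∀ n, ∀ u : K, ‖u - y‖ ≤ r → (evalMap f)^[n] u ≠ v) {ε : ℝ} (hε : 0 < ε) :
    ∃ δ > 0, ∀ z : P1 K, chordal (toP1 y) z < δ →
      ∀ n : ℕ, chordal ((polyMap f)^[n] (toP1 y)) ((polyMap f)^[n] z) < ε := by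
  set A := max ‖v‖ 1 with hA
  have hA1 : 1 ≤ A := le_max_right _ _
  have hvA : ‖v‖ ≤ A := le_max_left _ _
  obtain ⟨δ, hδ, hδ'⟩ := exists_chordal_lt_imp y (ε := min r (ε * r / A)) (by positivity)
  refine ⟨δ, hδ, fun z hz n => ?_⟩
  obtain ⟨u, rfl, hu⟩ := hδ' z hz
  have hur : ‖u - y‖ ≤ r := (hu.trans_le (min_le_left _ _)).le
  have hu2 := hu.trans_le (min_le_right _ _)
  rw [polyMap_iterate_toP1, polyMap_iterate_toP1]
  refine (chordal_toP1_le _ _).trans_lt ?_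
  have key := norm_eval_sub_eval_le (f.comp^[n] X) y v hr (fun w hw => by
    rw [← iterate_evalMap_eq_eval]; exact h n w hw) hur
  rw [← iterate_evalMap_eq_eval, ← iterate_evalMap_eq_eval] at key
  set P := (evalMap f)^[n] y
  have hP1 : 1 ≤ max ‖P‖ 1 := le_max_right _ _
  have hPv : ‖P - v‖ ≤ A * max ‖P‖ 1 := by
    refine (norm_sub_le_max_norm P v).trans (max_le ?_ ?_)
    · exact (le_max_left _ _).trans (le_mul_of_one_le_left (by positivity) hA1)
    · exact hvA.trans (le_mul_of_one_le_right (by positivity) hP1)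
  rw [div_lt_iff₀ (by positivity)]
  rw [lt_div_iff₀ (by positivity)] at hu2
  calc _ ≤ ‖P - v‖ / r * ‖u - y‖ := key
    _ ≤ A * max ‖P‖ 1 / r * ‖u - y‖ := by gcongr
    _ = (‖u - y‖ * A) / r * max ‖P‖ 1 := by ring
    _ < ε * max ‖P‖ 1 := by
      gcongr
      rwa [div_lt_iff₀ hr]

lemma toP1_mem_fatou_of_forall_ne {f : K[X]} {y v : K} {r : ℝ} (hr : 0 < r)
    (h : ∀ n, ∀ u : K, ‖u - y‖ ≤ r → (evalMap f)^[n] u ≠ v) : toP1 y ∈ fatou f := by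
  refine ⟨toP1 '' Metric.ball y r, ⟨y, Metric.mem_ball_self hr, rfl⟩,
    isRhoOpen_image_toP1 Metric.isOpen_ball, ?_⟩
  rintro _ ⟨w, hw, rfl⟩ ε hε
  rw [Metric.mem_ball, dist_eq_norm] at hw
  exact exists_forall_chordal_iterate_lt hr
    (fun n u hu => h n u (norm_sub_le_of_norm_sub_le hu hw.le)) hε

omit [IsUltrametricDist K] in
lemma exists_forall_iterate_ne_of_lt_norm_iterate {f : K[X]} {R : ℝ} (hf : IsEscapeRadius f R)
    (hd : 2 ≤ f.natDegree) {w : K} {n : ℕ} (hw : R < ‖(evalMap f)^[n] w‖) :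
    ∃ x : K, ∃ r > 0, ∀ m, ∀ u : K, ‖u - w‖ ≤ r → (evalMap f)^[m] u ≠ x := by
  obtain ⟨x, hx⟩ := exists_eval_eq_self hd
  have hxR : ‖x‖ ≤ R := by
    by_contra! h
    have := hf.2 x h
    rw [hx] at this
    linarith [hf.1]
  have hopen : IsOpen {u : K | R < ‖(evalMap f)^[n] u‖} :=
    isOpen_lt continuous_const (continuous_iterate_evalMap f n).norm
  obtain ⟨r, hr, h⟩ := Metric.nhds_basis_closedBall.mem_iff.1 (hopen.mem_nhds hw)
  refine ⟨x, r, hr, fun m u hu hux => ?_⟩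
  have hu' : R < ‖(evalMap f)^[n] u‖ := h (by rwa [Metric.mem_closedBall, dist_eq_norm])
  have h1 := hf.lt_norm_iterate_of_le (Nat.le_add_left n m) hu'
  rw [add_comm, Function.iterate_add_apply, hux, Function.iterate_fixed hx] at h1
  linarith

lemma infty_mem_fatou {f : K[X]} {R : ℝ} (hf : IsEscapeRadius f R) (hd : 2 ≤ f.natDegree) :
    P1.infty ∈ fatou f := by
  have hR1 := hf.1
  have hmem : ∀ y : P1 K, chordal P1.infty y < 1 / R → y = P1.infty ∨
      ∃ w : K, R < ‖w‖ ∧ y = toP1 w := by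
    rintro (_ | w) hw
    · exact Or.inl rfl
    · refine Or.inr ⟨w, ?_, rfl⟩
      change 1 / max ‖w‖ 1 < 1 / R at hw
      rw [one_div_lt_one_div (by positivity) (by positivity), lt_max_iff] at hw
      exact hw.resolve_right (by linarith)
  refine ⟨{P1.infty} ∪ toP1 '' {w : K | R < ‖w‖}, Or.inl rfl, ?_, ?_⟩
  · rintro y (rfl | hy)
    · refine ⟨1 / R, by positivity, fun y hy => ?_⟩
      rcases hmem y hy with rfl | ⟨w, hw, rfl⟩
      · exact Or.inl rfl
      · exact Or.inr ⟨w, hw, rfl⟩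
    · obtain ⟨ε, hε, h⟩ := isRhoOpen_image_toP1
        (isOpen_lt continuous_const continuous_norm : IsOpen {w : K | R < ‖w‖}) y hy
      exact ⟨ε, hε, fun z hz => Or.inr (h z hz)⟩
  · rintro y (rfl | ⟨w, hw, rfl⟩) ε hε
    · refine ⟨min ε (1 / R), by positivity, fun z hz n => ?_⟩
      rw [polyMap_iterate_infty]
      rcases hmem z (hz.trans_le (min_le_right _ _)) with rfl | ⟨w, hw, rfl⟩
      · rwa [polyMap_iterate_infty, chordal_infty_infty]
      · rw [polyMap_iterate_toP1]
        refine lt_of_le_of_lt ?_ (hz.trans_le (min_le_left _ _))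
        rw [chordal_infty_toP1, chordal_infty_toP1]
        gcongr
        exact hf.norm_le_norm_iterate hw n
    · obtain ⟨x, r, hr, h⟩ := exists_forall_iterate_ne_of_lt_norm_iterate hf hd (n := 0) hw
      exact exists_forall_chordal_iterate_lt hr h hε

/-- The Julia set is the boundary of the filled Julia set. -/
lemma julia_eq_image {f : K[X]} {R : ℝ} (hK : ∀ B : ℝ, ∃ v : K, B < ‖v‖)
    (hf : IsEscapeRadius f R) (hd : 2 ≤ f.natDegree) :
    julia f = toP1 '' boundaryFilledJulia f R := by
  have hR1 := hf.1
  ext y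
  constructor
  · intro hy
    rcases y with _ | w
    · exact absurd (infty_mem_fatou hf hd) hy
    · refine ⟨w, ⟨fun n => ?_, fun r hr => ?_⟩, rfl⟩
      · by_contra! hn
        obtain ⟨x, r, hr, h⟩ := exists_forall_iterate_ne_of_lt_norm_iterate hf hd hn
        exact hy (toP1_mem_fatou_of_forall_ne hr h)
      · by_contra! hn
        obtain ⟨v, hv⟩ := hK R
        refine hy (toP1_mem_fatou_of_forall_ne (v := v) hr fun n u hu hv' => ?_)
        have := hn u hu n
        rw [hv'] at this
        linarith
  · rintro ⟨w, ⟨hw, hw'⟩, rfl⟩ ⟨U, hU, -, h⟩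
    obtain ⟨δ, hδ, hδ'⟩ := h _ hU (1 / R) (by positivity)
    obtain ⟨u, hu, n, hn⟩ := hw' (δ / 2) (by positivity)
    have := hδ' (toP1 u) ((chordal_toP1_le_norm _ _).trans_lt (by linarith)) n
    rw [polyMap_iterate_toP1, polyMap_iterate_toP1, chordal_toP1] at this
    have hwn := hw n
    set a := (evalMap f)^[n] w
    set b := (evalMap f)^[n] u
    have hab : ‖a - b‖ = ‖b‖ := by
      rw [← norm_neg b]
      apply norm_eq_of_norm_sub_lt
      rw [norm_neg]
      simpa using hwn.trans_lt hn
    have hbpos : 0 < ‖b‖ := by linarith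
    rw [hab, max_eq_left (a := ‖b‖) (by linarith), div_lt_div_iff₀ (by positivity)
      (by positivity)] at this
    have : R < max ‖a‖ 1 := by
      by_contra! hc
      nlinarith
    exact absurd this (not_lt.2 (max_le hwn hR1))

end Julia

section Expanding

variable [NormedField K]

lemma eval_mem_boundaryFilledJulia {f : K[X]} {R : ℝ} (hf : IsEscapeRadius f R) {w : K}
    (hw : w ∈ boundaryFilledJulia f R) : f.eval w ∈ boundaryFilledJulia f R := by
  refine ⟨fun n => hw.1 (n + 1), fun r hr => ?_⟩
  obtain ⟨δ, hδ, h⟩ := Metric.continuous_iff.1 f.continuous w r hr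
  obtain ⟨u, hu, n, hn⟩ := hw.2 (δ / 2) (by positivity)
  refine ⟨f.eval u, ?_, n,
    show R < ‖(evalMap f)^[n + 1] u‖ from hf.lt_norm_iterate_of_le (Nat.le_succ n) hn⟩
  rw [← dist_eq_norm]
  exact (h u (by rw [dist_eq_norm]; linarith)).le

lemma iterate_mem_boundaryFilledJulia {f : K[X]} {R : ℝ} (hf : IsEscapeRadius f R) {w : K}
    (hw : w ∈ boundaryFilledJulia f R) (n : ℕ) :
    (evalMap f)^[n] w ∈ boundaryFilledJulia f R := by
  induction n with
  | zero => exact hw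
  | succ n ih =>
    rw [Function.iterate_succ_apply']
    exact eval_mem_boundaryFilledJulia hf ih

/-- The union of the closed discs of radius `s` centred at points of `J`. -/
def discNhd (J : Set K) (s : ℝ) : Set K := {z | ∃ x ∈ J, ‖z - x‖ ≤ s}

/-- The points whose forward orbit under `g` stays in `V`. -/
def stayingSet (g : K[X]) (V : Set K) : Set K := {w | ∀ n, (evalMap g)^[n] w ∈ V}

lemma eval_mem_stayingSet {g : K[X]} {V : Set K} {w : K} (hw : w ∈ stayingSet g V) :
    g.eval w ∈ stayingSet g V :=
  fun n => hw (n + 1)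

/-- `g` has the same expansion factors `m` as the reference map in the discs of radius `s`
centred at points of `J`, and preimages of the union of these discs stay in it. -/
structure IsExpandingNear (J : Set K) (m : K → ℝ) (R lam s : ℝ) (g : K[X]) : Prop where
  escape : IsEscapeRadius g R
  lam_le : ∀ x ∈ J, lam ≤ m x
  norm_le : ∀ x ∈ J, ‖x‖ ≤ R
  deriv : ∀ x ∈ J, ∀ z, ‖z - x‖ ≤ s → ‖(derivative g).eval z‖ = m x
  scale : ∀ x ∈ J, ∀ u v, ‖u - x‖ ≤ s → ‖v - x‖ ≤ s → ‖g.eval u - g.eval v‖ = m x * ‖u - v‖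
  preimage : ∀ u, g.eval u ∈ discNhd J s → u ∈ discNhd J s

variable [IsUltrametricDist K]

lemma mem_discNhd_of_norm_sub_le {J : Set K} {s : ℝ} {x y : K} (hx : x ∈ discNhd J s)
    (h : ‖y - x‖ ≤ s) : y ∈ discNhd J s := by
  obtain ⟨z, hz, hxz⟩ := hx
  exact ⟨z, hz, norm_sub_le_of_norm_sub_le h hxz⟩

variable [IsAlgClosed K]

lemma mem_boundaryFilledJulia_of_eval_mem {f : K[X]} {R : ℝ} (hf : IsEscapeRadius f R)
    (hd : 1 ≤ f.natDegree) {w : K} (hw : f.eval w ∈ boundaryFilledJulia f R) :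
    w ∈ boundaryFilledJulia f R := by
  refine ⟨fun n => ?_, fun r hr => ?_⟩
  · rcases n with _ | n
    · exact hf.norm_le_of_norm_eval_le (hw.1 0)
    · exact hw.1 n
  · have ha : 0 < ‖f.leadingCoeff‖ := by
      rw [norm_pos_iff, leadingCoeff_ne_zero]
      rintro rfl
      simp at hd
    obtain ⟨v, hv, n, hn⟩ := hw.2 (‖f.leadingCoeff‖ * r ^ f.natDegree) (by positivity)
    obtain ⟨u, hu, rfl⟩ := exists_eval_eq_of_leadingCoeff f w v hr.le hd
      (by rwa [norm_sub_rev])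
    exact ⟨u, hu, n + 1, hn⟩

namespace IsExpandingNear

variable {J : Set K} {m : K → ℝ} {R lam s : ℝ} {f g : K[X]}

omit [IsUltrametricDist K] [IsAlgClosed K] in
lemma lam_le_derivative (hg : IsExpandingNear J m R lam s g) {x : K} (hx : x ∈ discNhd J s) :
    lam ≤ ‖(derivative g).eval x‖ := by
  obtain ⟨z, hz, hxz⟩ := hx
  rw [hg.deriv z hz x hxz]
  exact hg.lam_le z hz

omit [IsAlgClosed K] in
lemma lam_mul_le (hg : IsExpandingNear J m R lam s g) {x u v : K} (hx : x ∈ discNhd J s)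
    (hu : ‖u - x‖ ≤ s) (hv : ‖v - x‖ ≤ s) : lam * ‖u - v‖ ≤ ‖g.eval u - g.eval v‖ := by
  obtain ⟨z, hz, hxz⟩ := hx
  rw [hg.scale z hz u v (norm_sub_le_of_norm_sub_le hu hxz)
    (norm_sub_le_of_norm_sub_le hv hxz)]
  gcongr
  exact hg.lam_le z hz

omit [IsAlgClosed K] in
lemma norm_le_of_mem_discNhd (hg : IsExpandingNear J m R lam s g) (hsR : s ≤ R) {x : K}
    (hx : x ∈ discNhd J s) : ‖x‖ ≤ R := by
  obtain ⟨z, hz, hxz⟩ := hx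
  exact norm_le_of_norm_sub_le (hxz.trans hsR) (hg.norm_le z hz)

/-- Along an orbit staying near `J`, discs are mapped over discs of exponentially growing
radius. -/
lemma exists_iterate_eq (hg : IsExpandingNear J m R lam s g) (hlam : 1 < lam) {r : ℝ}
    (hr : 0 < r) {w : K} (hw : w ∈ stayingSet g (discNhd J s)) (n : ℕ) :
    ∀ v : K, ‖(evalMap g)^[n] w - v‖ ≤ lam ^ n * r →
      ∃ u : K, ‖u - w‖ ≤ r ∧ (evalMap g)^[n] u = v := by
  induction n with
  | zero => exact fun v hv => ⟨v, by simpa [norm_sub_rev] using hv, rfl⟩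
  | succ n ih =>
    intro v hv
    rw [Function.iterate_succ_apply'] at hv
    obtain ⟨t, ht, rfl⟩ := exists_eval_eq_of_derivative g ((evalMap g)^[n] w) v
      (ρ := lam ^ n * r) (by positivity) (hv.trans (by
        rw [pow_succ', mul_assoc]
        gcongr
        exact hg.lam_le_derivative (hw n)))
    obtain ⟨u, hu, rfl⟩ := ih t (by rwa [norm_sub_rev])
    exact ⟨u, hu, Function.iterate_succ_apply' _ _ _⟩

lemma boundaryFilledJulia_eq (hg : IsExpandingNear J m R lam s g) (hK : ∀ B : ℝ, ∃ v : K, B < ‖v‖)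
    (hlam : 1 < lam) (hs : 0 < s) (hsR : s ≤ R) (hJ : J.Nonempty) :
    boundaryFilledJulia g R = stayingSet g (discNhd J s) := by
  have hpre : ∀ n u, (evalMap g)^[n] u ∈ discNhd J s → u ∈ discNhd J s := by
    intro n
    induction n with
    | zero => exact fun u hu => hu
    | succ n ih => exact fun u hu => hg.preimage u (ih _ hu)
  have hsub : boundaryFilledJulia g R ⊆ discNhd J s := by
    intro w hw
    by_contra hwV
    obtain ⟨x, hx⟩ := hJ
    have hxV : x ∈ discNhd J s := ⟨x, hx, by simpa using hs.le⟩
    obtain ⟨u, hu, n, hn⟩ := hw.2 s hs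
    have homit : ∀ t : K, ‖t - w‖ ≤ s → (g.comp^[n] X).eval t ≠ x := by
      intro t ht htx
      rw [← iterate_evalMap_eq_eval] at htx
      refine hwV (mem_discNhd_of_norm_sub_le (hpre n t (htx ▸ hxV)) ?_)
      rwa [norm_sub_rev]
    have key := norm_eval_sub_eval_le _ w x hs homit hu
    rw [← iterate_evalMap_eq_eval, ← iterate_evalMap_eq_eval] at key
    have h1 : ‖(evalMap g)^[n] w - x‖ ≤ R :=
      (norm_sub_le_max_norm _ _).trans (max_le (hw.1 n) (hg.norm_le x hx))
    have h2 : ‖(evalMap g)^[n] u - (evalMap g)^[n] w‖ ≤ R := by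
      refine key.trans (le_trans ?_ h1)
      rw [div_mul_eq_mul_div, div_le_iff₀ hs]
      gcongr
    exact absurd hn (not_lt.2 (norm_le_of_norm_sub_le h2 (hw.1 n)))
  apply Set.Subset.antisymm
  · exact fun w hw n => hsub (iterate_mem_boundaryFilledJulia hg.escape hw n)
  · intro w hw
    have hb : ∀ n, ‖(evalMap g)^[n] w‖ ≤ R := fun n => hg.norm_le_of_mem_discNhd hsR (hw n)
    refine ⟨hb, fun r hr => ?_⟩
    obtain ⟨v, hv⟩ := hK R
    obtain ⟨n, hn⟩ := pow_unbounded_of_one_lt (‖v‖ / r) hlam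
    rw [div_lt_iff₀ hr] at hn
    obtain ⟨u, hu, hu'⟩ := hg.exists_iterate_eq hlam hr hw n v (by
      refine le_trans ?_ hn.le
      exact (norm_sub_le_max_norm _ _).trans (max_le ((hb n).trans hv.le) le_rfl))
    exact ⟨u, hu, n, by rwa [hu']⟩

omit [IsAlgClosed K] in
lemma lam_pow_mul_le (hg : IsExpandingNear J m R lam s g) (hlam : 1 < lam) {x : ℕ → K} {y y' : K}
    (n : ℕ) (hx : ∀ k, x k ∈ discNhd J s) (hy : ∀ k ≤ n, ‖(evalMap g)^[k] y - x k‖ ≤ s)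
    (hy' : ∀ k ≤ n, ‖(evalMap g)^[k] y' - x k‖ ≤ s) : lam ^ n * ‖y - y'‖ ≤ s := by
  have : ∀ k ≤ n, lam ^ k * ‖y - y'‖ ≤ ‖(evalMap g)^[k] y - (evalMap g)^[k] y'‖ := by
    intro k
    induction k with
    | zero => simp
    | succ k ih =>
      intro hk
      rw [Function.iterate_succ_apply', Function.iterate_succ_apply', pow_succ', mul_assoc]
      refine le_trans ?_ (hg.lam_mul_le (hx k) (hy k (by omega)) (hy' k (by omega)))
      gcongr
      exact ih (by omega)
  refine (this n le_rfl).trans (norm_sub_le_of_norm_sub_le (hy n le_rfl) ?_)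
  rw [norm_sub_rev]
  exact hy' n le_rfl

/-- Pseudo-orbits near `J` are shadowed by orbits. -/
lemma exists_shadow [CompleteSpace K] (hg : IsExpandingNear J m R lam s g) (hlam : 1 < lam)
    (hs : 0 < s) {x : ℕ → K} (hx : ∀ k, x k ∈ discNhd J s)
    (hxg : ∀ k, ‖g.eval (x k) - x (k + 1)‖ ≤ s) :
    ∃ y : K, ∀ n, ‖(evalMap g)^[n] y - x n‖ ≤ s := by
  have hfin : ∀ n, ∀ t : K, ‖t - x n‖ ≤ s →
      ∃ y, (evalMap g)^[n] y = t ∧ ∀ k ≤ n, ‖(evalMap g)^[k] y - x k‖ ≤ s := by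
    intro n
    induction n with
    | zero =>
      intro t ht
      refine ⟨t, rfl, fun k hk => ?_⟩
      obtain rfl : k = 0 := by omega
      exact ht
    | succ n ih =>
      intro t ht
      obtain ⟨t', ht', rfl⟩ := exists_eval_eq_of_derivative g (x n) t hs.le (by
        have h1 : ‖g.eval (x n) - t‖ ≤ s :=
          norm_sub_le_of_norm_sub_le (hxg n) (by rwa [norm_sub_rev])
        have h2 := hlam.le.trans (hg.lam_le_derivative (hx n))
        nlinarith)
      obtain ⟨y, hy, hyk⟩ := ih t' ht'
      have hy1 : (evalMap g)^[n + 1] y = g.eval t' := by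
        rw [Function.iterate_succ_apply', hy]
      refine ⟨y, hy1, fun k hk => ?_⟩
      rcases Nat.lt_or_ge n k with hnk | hnk
      · obtain rfl : k = n + 1 := by omega
        rwa [hy1]
      · exact hyk k hnk
  choose y hy hyk using fun n => hfin n (x n) (by simpa using hs.le)
  have hcauchy : CauchySeq y := by
    refine cauchySeq_of_le_geometric lam⁻¹ s (inv_lt_one_of_one_lt₀ hlam) fun n => ?_
    have h := hg.lam_pow_mul_le hlam n hx (hyk n) fun k hk => hyk (n + 1) k (by omega)
    rw [dist_eq_norm, inv_pow, ← div_eq_mul_inv, le_div_iff₀ (by positivity), mul_comm]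
    exact h
  obtain ⟨z, hz⟩ := cauchySeq_tendsto_of_complete hcauchy
  refine ⟨z, fun k => ?_⟩
  have hlim := ((((continuous_iterate_evalMap g k).tendsto z).comp hz).sub_const (x k)).norm
  exact le_of_tendsto hlim (Filter.eventually_atTop.2 ⟨k, fun n hn => hyk n k hn⟩)

lemma exists_mem_stayingSet [CompleteSpace K] (hf : IsExpandingNear J m R lam s f)
    (hg : IsExpandingNear J m R lam s g) (hlam : 1 < lam) (hs : 0 < s) (hsR : s ≤ R)
    (hfg : ∀ z, ‖z‖ ≤ R → ‖g.eval z - f.eval z‖ ≤ s) {x : K}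
    (hx : x ∈ stayingSet f (discNhd J s)) :
    ∃ y ∈ stayingSet g (discNhd J s), ∀ n, ‖(evalMap g)^[n] y - (evalMap f)^[n] x‖ ≤ s := by
  obtain ⟨y, hy⟩ := hg.exists_shadow hlam hs hx fun k => by
    rw [Function.iterate_succ_apply']
    exact hfg _ (hf.norm_le_of_mem_discNhd hsR (hx k))
  exact ⟨y, fun n => mem_discNhd_of_norm_sub_le (hx n) (hy n), hy⟩

omit [IsAlgClosed K] in
/-- Passing to the shadowing orbit preserves distances. -/
lemma norm_sub_eq_of_shadow (hf : IsExpandingNear J m R lam s f)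
    (hg : IsExpandingNear J m R lam s g) (hlam : 1 < lam) {x x' y y' : K}
    (hx : x ∈ stayingSet f (discNhd J s)) (hx' : x' ∈ stayingSet f (discNhd J s))
    (hy : ∀ n, ‖(evalMap g)^[n] y - (evalMap f)^[n] x‖ ≤ s)
    (hy' : ∀ n, ‖(evalMap g)^[n] y' - (evalMap f)^[n] x'‖ ≤ s) :
    ‖y - y'‖ = ‖x - x'‖ := by
  by_cases hclose : ∀ n, ‖(evalMap f)^[n] x' - (evalMap f)^[n] x‖ ≤ s
  · have hzero : ∀ t : ℝ, 0 ≤ t → (∀ n : ℕ, lam ^ n * t ≤ s) → t = 0 := by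
      intro t ht h
      by_contra hne
      have htpos : 0 < t := lt_of_le_of_ne ht (Ne.symm hne)
      obtain ⟨n, hn⟩ := pow_unbounded_of_one_lt (s / t) hlam
      rw [div_lt_iff₀ htpos] at hn
      exact absurd hn (not_lt.2 (h n))
    rw [hzero ‖x - x'‖ (norm_nonneg _) fun n => hf.lam_pow_mul_le hlam n hx
        (fun k _ => by simpa using (norm_nonneg _).trans (hclose 0)) (fun k _ => hclose k),
      hzero ‖y - y'‖ (norm_nonneg _) fun n => hg.lam_pow_mul_le hlam n hx
        (fun k _ => hy k) (fun k _ => norm_sub_le_of_norm_sub_le (hy' k) (hclose k))]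
  · push Not at hclose
    obtain ⟨n, hn⟩ := hclose
    have hfar : ∀ x x' y y' : K, ‖y - x‖ ≤ s → ‖y' - x'‖ ≤ s → s < ‖x' - x‖ →
        ‖y - y'‖ = ‖x - x'‖ := by
      intro x x' y y' h h' hs
      apply norm_eq_of_norm_sub_lt
      rw [sub_sub_sub_comm, norm_sub_rev x x']
      exact ((norm_sub_le_max_norm _ _).trans (max_le h h')).trans_lt hs
    induction n generalizing x x' y y' with
    | zero => exact hfar _ _ _ _ (hy 0) (hy' 0) hn
    | succ n ih =>
      by_cases h0 : s < ‖x' - x‖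
      · exact hfar _ _ _ _ (hy 0) (hy' 0) h0
      · rw [not_lt] at h0
        have key := ih (eval_mem_stayingSet hx) (eval_mem_stayingSet hx')
          (fun n => hy (n + 1)) (fun n => hy' (n + 1)) hn
        obtain ⟨z, hz, hxz⟩ := hx 0
        change ‖x - z‖ ≤ s at hxz
        have hx'z := norm_sub_le_of_norm_sub_le h0 hxz
        rw [hf.scale z hz x x' hxz hx'z,
          hg.scale z hz y y' (norm_sub_le_of_norm_sub_le (hy 0) hxz)
            (norm_sub_le_of_norm_sub_le (hy' 0) hx'z)] at key
        have := hf.lam_le z hz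
        exact mul_left_cancel₀ (by linarith) key

/-- Two nearby polynomials expanding near `J` are conjugate on their sets of points staying
near `J`, by an isometry. -/
lemma exists_isometryEquiv [CompleteSpace K] (hf : IsExpandingNear J m R lam s f)
    (hg : IsExpandingNear J m R lam s g) (hlam : 1 < lam) (hs : 0 < s) (hsR : s ≤ R)
    (hfg : ∀ z, ‖z‖ ≤ R → ‖f.eval z - g.eval z‖ ≤ s) :
    ∃ e : stayingSet f (discNhd J s) ≃ᵢ stayingSet g (discNhd J s),
      ∀ x (hx : x ∈ stayingSet f (discNhd J s)),
        (e ⟨f.eval x, eval_mem_stayingSet hx⟩ : K) = g.eval (e ⟨x, hx⟩ : K) := by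
  have hgf : ∀ z, ‖z‖ ≤ R → ‖g.eval z - f.eval z‖ ≤ s := fun z hz => by
    rw [norm_sub_rev]; exact hfg z hz
  choose h hmem hh using fun x : stayingSet f (discNhd J s) =>
    hf.exists_mem_stayingSet hg hlam hs hsR hgf x.2
  choose k kmem hk using fun y : stayingSet g (discNhd J s) =>
    hg.exists_mem_stayingSet hf hlam hs hsR hfg y.2
  have huniq : ∀ {x y y' : K}, x ∈ stayingSet f (discNhd J s) →
      (∀ n, ‖(evalMap g)^[n] y - (evalMap f)^[n] x‖ ≤ s) →
      (∀ n, ‖(evalMap g)^[n] y' - (evalMap f)^[n] x‖ ≤ s) → y = y' := by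
    intro x y y' hx hy hy'
    have := hf.norm_sub_eq_of_shadow hg hlam hx hx hy hy'
    rwa [sub_self, norm_zero, norm_eq_zero, sub_eq_zero] at this
  refine ⟨IsometryEquiv.mk' (fun x => ⟨h x, hmem x⟩) (fun y => ⟨k y, kmem y⟩) (fun y => ?_) ?_,
    fun x hx => ?_⟩
  · refine Subtype.ext (huniq (kmem y) (hh ⟨k y, kmem y⟩) fun n => ?_)
    rw [norm_sub_rev]
    exact hk y n
  · refine Isometry.of_dist_eq fun x x' => ?_
    rw [Subtype.dist_eq, Subtype.dist_eq, dist_eq_norm, dist_eq_norm]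
    exact hf.norm_sub_eq_of_shadow hg hlam x.2 x'.2 (hh x) (hh x')
  · exact huniq (eval_mem_stayingSet hx) (hh ⟨f.eval x, eval_mem_stayingSet hx⟩)
      fun n => hh ⟨x, hx⟩ (n + 1)

end IsExpandingNear

omit [IsUltrametricDist K] [IsAlgClosed K] in
lemma juliaConjugate_of_homeomorph {f g : K[X]} {A B : Set K} (hA : julia f = toP1 '' A)
    (hB : julia g = toP1 '' B) (hfA : ∀ x ∈ A, f.eval x ∈ A) (e : A ≃ₜ B)
    (he : ∀ x (hx : x ∈ A), (e ⟨f.eval x, hfA x hx⟩ : K) = g.eval (e ⟨x, hx⟩ : K)) :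
    JuliaConjugate f g := by
  have hemb : Topology.IsEmbedding (toP1 : K → P1 K) := isOpenEmbedding_toP1.isEmbedding
  let φ : julia f ≃ₜ julia g :=
    (Homeomorph.setCongr hA).trans ((hemb.homeomorphImage A).symm.trans
      (e.trans ((hemb.homeomorphImage B).trans (Homeomorph.setCongr hB.symm))))
  have hφ : ∀ x (hx : x ∈ A) (hx' : toP1 x ∈ julia f),
      (φ ⟨toP1 x, hx'⟩ : P1 K) = toP1 (e ⟨x, hx⟩ : K) := by
    intro x hx hx'
    have : (hemb.homeomorphImage A).symm ⟨toP1 x, ⟨x, hx, rfl⟩⟩ = ⟨x, hx⟩ :=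
      (hemb.homeomorphImage A).symm_apply_eq.2 rfl
    change toP1 (e ((hemb.homeomorphImage A).symm ⟨toP1 x, _⟩) : K) = _
    rw [this]
  refine ⟨φ, fun z hz => ?_⟩
  obtain ⟨x, hx, rfl⟩ : z ∈ toP1 '' A := hA ▸ hz
  have hfx : toP1 (f.eval x) ∈ julia f := hA ▸ ⟨_, hfA x hx, rfl⟩
  refine ⟨hfx, ?_⟩
  change (φ ⟨toP1 (f.eval x), hfx⟩ : P1 K) = _
  rw [hφ _ (hfA x hx), hφ x hx, he x hx]
  rfl

end Expanding

section Perturbation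

variable [NormedField K] [IsUltrametricDist K]

lemma isEscapeRadius_of_coeff_le {g : K[X]} {d : ℕ} (hd : 2 ≤ d) (hg : g.natDegree = d)
    {a B R : ℝ} (ha : 0 < a) (hB : 0 ≤ B) (hga : ‖g.coeff d‖ = a) (hgB : ∀ k, ‖g.coeff k‖ ≤ B)
    (hR : 1 ≤ R) (hBR : B + 2 ≤ a * R) : IsEscapeRadius g R := by
  refine ⟨hR, fun z hz => ?_⟩
  obtain ⟨e, rfl⟩ : ∃ e, d = e + 2 := ⟨d - 2, by omega⟩
  have hz1 : 1 ≤ ‖z‖ := hR.trans hz.le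
  have hpow : ‖z‖ ≤ ‖z‖ ^ (e + 1) := le_self_pow₀ hz1 (by omega)
  have hlow : ‖∑ k ∈ Finset.range (e + 2), g.coeff k * z ^ k‖ ≤ B * ‖z‖ ^ (e + 1) := by
    refine IsUltrametricDist.norm_sum_le_of_forall_le_of_nonneg (by positivity) fun k hk => ?_
    rw [Finset.mem_range] at hk
    rw [norm_mul, norm_pow]
    have : k ≤ e + 1 := by omega
    gcongr
    exact hgB k
  have htop : ‖g.coeff (e + 2) * z ^ (e + 2)‖ = a * ‖z‖ * ‖z‖ ^ (e + 1) := by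
    rw [norm_mul, norm_pow, hga]
    ring
  have heval : g.eval z = ∑ k ∈ Finset.range (e + 2), g.coeff k * z ^ k
      + g.coeff (e + 2) * z ^ (e + 2) := by
    rw [eval_eq_sum_range, hg, Finset.sum_range_succ]
  have htri := norm_sub_le (g.eval z) (∑ k ∈ Finset.range (e + 2), g.coeff k * z ^ k)
  rw [heval, add_sub_cancel_left, ← heval, htop] at htri
  have haz : a * R ≤ a * ‖z‖ := by gcongr
  have : (B + 2) * ‖z‖ ^ (e + 1) ≤ a * ‖z‖ * ‖z‖ ^ (e + 1) := by
    gcongr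
    linarith
  nlinarith

/-- Polynomials close to an expanding polynomial are expanding near its Julia set. -/
lemma isExpandingNear_of_close [IsAlgClosed K] {f g : K[X]} {d : ℕ} {B R lam r s : ℝ}
    (hd : 1 ≤ d) (hf : f.natDegree = d) (hg : g.natDegree = d) (hB : 0 ≤ B)
    (hfB : ∀ k, ‖f.coeff k‖ ≤ B) (hgB : ∀ k, ‖g.coeff k‖ ≤ B)
    (hfR : IsEscapeRadius f R) (hgR : IsEscapeRadius g R) (hlam : 1 < lam)
    (hexp : ∀ x ∈ boundaryFilledJulia f R, lam ≤ ‖(derivative f).eval x‖)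
    (hr0 : 0 ≤ r) (hr : r ≤ 1) (hBr : B * R ^ d * r ≤ 1) (hsr : s ≤ r)
    (hsr' : s ≤ ‖f.leadingCoeff‖ * r ^ d)
    (hfg : ∀ z, ‖z‖ ≤ R → ‖f.eval z - g.eval z‖ ≤ s)
    (hfg' : ∀ z, ‖z‖ ≤ R → ‖(derivative g).eval z - (derivative f).eval z‖ ≤ s) :
    IsExpandingNear (boundaryFilledJulia f R) (fun x => ‖(derivative f).eval x‖) R lam s g := by
  have hR := hfR.1
  have hnorm : ∀ x ∈ boundaryFilledJulia f R, ‖x‖ ≤ R := fun x hx => hx.1 0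
  have hder : ∀ x ∈ boundaryFilledJulia f R,
      ‖(derivative g).eval x‖ = ‖(derivative f).eval x‖ := fun x hx => by
    apply norm_eq_of_norm_sub_lt
    exact ((hfg' x (hnorm x hx)).trans (hsr.trans hr)).trans_lt (hlam.trans_le (hexp x hx))
  have hscale : ∀ x ∈ boundaryFilledJulia f R, ∀ u v, ‖u - x‖ ≤ s → ‖v - x‖ ≤ s →
      ‖(derivative g).eval v‖ = ‖(derivative f).eval x‖ ∧
        ‖g.eval u - g.eval v‖ = ‖(derivative f).eval x‖ * ‖u - v‖ := fun x hx u v hu hv => by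
    have := norm_eval_sub_eval_eq hB hR hr hBr hg.le hgB (hnorm x hx)
      (by have := hexp x hx; rw [← hder x hx] at this; exact hlam.trans_le this)
      (hu.trans hsr) (hv.trans hsr)
    rwa [hder x hx] at this
  refine ⟨hgR, hexp, hnorm, fun x hx z hz => (hscale x hx z z hz hz).1,
    fun x hx u v hu hv => (hscale x hx u v hu hv).2, ?_⟩
  rintro u ⟨y, hy, huy⟩
  have hsR : s ≤ R := hsr.trans (hr.trans hR)
  have huR : ‖u‖ ≤ R :=
    hgR.norm_le_of_norm_eval_le (norm_le_of_norm_sub_le (huy.trans hsR) (hy.1 0))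
  have hfuy : ‖f.eval u - y‖ ≤ s := norm_sub_le_of_norm_sub_le (hfg u huR) huy
  obtain ⟨x, hxu, rfl⟩ := exists_eval_eq_of_leadingCoeff f u y hr0 (hf ▸ hd)
    (by rw [hf]; exact hfuy.trans hsr')
  have hx := mem_boundaryFilledJulia_of_eval_mem hfR (hf ▸ hd) hy
  refine ⟨x, hx, ?_⟩
  have hlamx := hexp x hx
  have := (norm_eval_sub_eval_eq hB hR hr hBr hf.le hfB (hnorm x hx) (hlam.trans_le hlamx)
    (u := u) (v := x) (by rwa [norm_sub_rev]) (by simpa using hr0)).2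
  rw [this] at hfuy
  nlinarith [norm_nonneg (u - x)]

end Perturbation

/-- **Theorem 1 (J-stability of immediately expanding polynomial maps).**
If a polynomial map `f` of degree `d ≥ 2` over `ℂ_p` is immediately expanding (its Julia set
is non-empty and `|f'| ≥ λ > 1` on it), then `f` is `J`-stable in `Poly_d(ℂ_p)`. -/
theorem j_stable_of_immediately_expanding
    {p : ℕ} [Fact (Nat.Prime p)] {K : Type*} [NormedField K] [IsAlgClosed K]
    [CompleteSpace K] [IsUltrametricDist K] [Algebra ℚ_[p] K]
    (hext : ∀ q : ℚ_[p], ‖algebraMap ℚ_[p] K q‖ = ‖q‖)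
    (d : ℕ) (hd : 2 ≤ d) (f : K[X]) (hdeg : f.natDegree = d)
    (hJ : (julia f).Nonempty)
    (hexp : ∃ lam : ℝ, 1 < lam ∧ ∀ z : K, toP1 z ∈ julia f → lam ≤ ‖(derivative f).eval z‖) :
    ∃ ε > 0, ∀ g : K[X], g.natDegree = d →
      (∀ k ≤ d, ‖f.coeff k - g.coeff k‖ < ε) → JuliaConjugate f g := by
  obtain ⟨lam, hlam, hexp⟩ := hexp
  have hK : ∀ B : ℝ, ∃ v : K, B < ‖v‖ := fun B => by
    have hp : (1 : ℝ) < p := by exact_mod_cast (Fact.out : p.Prime).one_lt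
    obtain ⟨n, hn⟩ := pow_unbounded_of_one_lt B hp
    refine ⟨algebraMap ℚ_[p] K ((p : ℚ_[p])⁻¹ ^ n), ?_⟩
    rw [hext, norm_pow, norm_inv, Padic.norm_p, inv_inv]
    exact hn
  set a := ‖f.leadingCoeff‖ with ha
  have ha0 : 0 < a := by
    rw [ha, norm_pos_iff, leadingCoeff_ne_zero]
    rintro rfl
    rw [natDegree_zero] at hdeg
    omega
  have hfd : ‖f.coeff d‖ = a := by rw [ha, leadingCoeff, hdeg]
  set B : ℝ := ∑ k ∈ Finset.range (d + 1), ‖f.coeff k‖ + 1 with hBdef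
  have hsum : 0 ≤ ∑ k ∈ Finset.range (d + 1), ‖f.coeff k‖ :=
    Finset.sum_nonneg fun _ _ => norm_nonneg _
  have hB1 : 1 ≤ B := by linarith
  have hB0 : 0 ≤ B := by linarith
  have hfB : ∀ k, ‖f.coeff k‖ ≤ B := fun k => by
    rcases Nat.lt_or_ge d k with hk | hk
    · rw [coeff_eq_zero_of_natDegree_lt (hdeg ▸ hk), norm_zero]
      exact hB0
    · have := Finset.single_le_sum (f := fun k => ‖f.coeff k‖) (fun _ _ => norm_nonneg _)
        (Finset.mem_range.2 (Nat.lt_succ_of_le hk))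
      linarith
  set R : ℝ := max 1 ((B + 2) / a)
  have hR : 1 ≤ R := le_max_left _ _
  have hBR : B + 2 ≤ a * R := by
    have : (B + 2) / a ≤ R := le_max_right _ _
    rwa [div_le_iff₀' ha0] at this
  have hfR : IsEscapeRadius f R := isEscapeRadius_of_coeff_le hd hdeg ha0 hB0 hfd hfB hR hBR
  have hRd : 1 ≤ R ^ d := one_le_pow₀ hR
  have hM : 1 ≤ B * R ^ d := one_le_mul_of_one_le_of_one_le hB1 hRd
  set r : ℝ := (B * R ^ d)⁻¹
  have hr0 : 0 < r := by positivity
  have hr1 : r ≤ 1 := inv_le_one_of_one_le₀ hM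
  have hBr : B * R ^ d * r ≤ 1 := (mul_inv_cancel₀ (by positivity)).le
  set s : ℝ := min r (a * r ^ d)
  have hs0 : 0 < s := by positivity
  have hsr : s ≤ r := min_le_left _ _
  have hsr' : s ≤ a * r ^ d := min_le_right _ _
  have hsR : s ≤ R := hsr.trans (hr1.trans hR)
  have hjf := julia_eq_image hK hfR (hdeg ▸ hd)
  have hJ' : (boundaryFilledJulia f R).Nonempty := by
    rw [hjf] at hJ
    exact hJ.of_image
  have hexp' : ∀ x ∈ boundaryFilledJulia f R, lam ≤ ‖(derivative f).eval x‖ :=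
    fun x hx => hexp x (hjf ▸ ⟨x, hx, rfl⟩)
  have hfE := isExpandingNear_of_close (by omega) hdeg hdeg hB0 hfB hfB hfR hfR hlam hexp' hr0.le
    hr1 hBr hsr hsr' (fun z _ => by simpa using hs0.le) (fun z _ => by simpa using hs0.le)
  refine ⟨min a (s / R ^ d), by positivity, fun g hgd hfg => ?_⟩
  have hdiff : ∀ k, ‖(f - g).coeff k‖ ≤ s / R ^ d := fun k => by
    rw [coeff_sub]
    rcases Nat.lt_or_ge d k with hk | hk
    · rw [coeff_eq_zero_of_natDegree_lt (hdeg ▸ hk), coeff_eq_zero_of_natDegree_lt (hgd ▸ hk),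
        sub_zero, norm_zero]
      positivity
    · exact ((hfg k hk).trans_le (min_le_right _ _)).le
  have hdegsub : (f - g).natDegree ≤ d :=
    (natDegree_sub_le f g).trans (max_le hdeg.le hgd.le)
  have hsB : s / R ^ d ≤ B :=
    (div_le_self hs0.le hRd).trans ((hsr.trans hr1).trans hB1)
  have hgB : ∀ k, ‖g.coeff k‖ ≤ B := fun k => by
    refine norm_le_of_norm_sub_le (b := f.coeff k) ?_ (hfB k)
    rw [norm_sub_rev, ← coeff_sub]
    exact (hdiff k).trans hsB
  have hga : ‖g.coeff d‖ = a := by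
    rw [← hfd]
    apply norm_eq_of_norm_sub_lt
    rw [norm_sub_rev, hfd]
    exact (hfg d le_rfl).trans_le (min_le_left _ _)
  have hgR : IsEscapeRadius g R := isEscapeRadius_of_coeff_le hd hgd ha0 hB0 hga hgB hR hBR
  have hcancel : s / R ^ d * R ^ d = s := div_mul_cancel₀ _ (by positivity)
  have hclose : ∀ z, ‖z‖ ≤ R → ‖f.eval z - g.eval z‖ ≤ s := fun z hz => by
    rw [← eval_sub, ← hcancel]
    exact norm_eval_le (by positivity) hR hdegsub hdiff hz
  have hclose' : ∀ z, ‖z‖ ≤ R → ‖(derivative g).eval z - (derivative f).eval z‖ ≤ s :=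
    fun z hz => by
      rw [norm_sub_rev, ← eval_sub, ← derivative_sub, ← hcancel]
      exact norm_eval_le (by positivity) hR ((natDegree_derivative_le _).trans (by omega))
        (norm_coeff_derivative_le hdiff) hz
  have hgE := isExpandingNear_of_close (by omega) hdeg hgd hB0 hfB hgB hfR hgR hlam hexp' hr0.le
    hr1 hBr hsr hsr' hclose hclose'
  obtain ⟨e, he⟩ := hfE.exists_isometryEquiv hgE hlam hs0 hsR hclose
  exact juliaConjugate_of_homeomorph
    (hjf.trans (congrArg _ (hfE.boundaryFilledJulia_eq hK hlam hs0 hsR hJ')))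
    ((julia_eq_image hK hgR (hgd ▸ hd)).trans
      (congrArg _ (hgE.boundaryFilledJulia_eq hK hlam hs0 hsR hJ')))
    (fun x hx => eval_mem_stayingSet hx) e.toHomeomorph he
end
end

section
/- Let f be a polynomial map of degree d ≥ 2 over ℂ_p, let z_0 ∈ ℂ_p and δ > 0, and write f(z) = c_0 + c_1(z − z_0) + ⋯ + c_d(z − z_0)^d, so that c_l = f^{(l)}(z_0)/l!. If the derivative f' has no zeros in the disk D̄_δ(z_0), then for every l ∈ {2, 3, …, d} one has |l| · |c_l| · δ^{l−1} < |c_1| = |f'(z_0)|, where |l| denotes the p-adic absolute value of the integer l. -/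
open Polynomial

noncomputable section

variable {K : Type*}

/-- Over an ultrametric field, the coefficients of a monic polynomial all of whose roots have norm
greater than `δ` are dominated, on the disk of radius `δ`, by the constant coefficient. -/
theorem norm_coeff_prod_X_sub_C_mul_pow_lt {F : Type*} [NormedField F] [IsUltrametricDist F]
    {δ : ℝ} (hδ : 0 < δ) (s : Multiset F) (hs : ∀ a ∈ s, δ < ‖a‖) :
    0 < ‖(s.map fun a => X - C a).prod.coeff 0‖ ∧
      ∀ k, ‖(s.map fun a => X - C a).prod.coeff (k + 1)‖ * δ ^ (k + 1) <
        ‖(s.map fun a => X - C a).prod.coeff 0‖ := by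
  induction s using Multiset.induction_on with
  | empty => simp [coeff_one]
  | cons a s ih =>
    obtain ⟨h₀, h⟩ := ih fun b hb => hs b (Multiset.mem_cons_of_mem hb)
    have ha : δ < ‖a‖ := hs a (Multiset.mem_cons_self a s)
    have ha₀ : 0 < ‖a‖ := hδ.trans ha
    rw [Multiset.map_cons, Multiset.prod_cons]
    generalize (s.map fun a => X - C a).prod = P at h₀ h
    have hle : ∀ k, ‖P.coeff k‖ * δ ^ k ≤ ‖P.coeff 0‖ := by
      rintro (_ | k)
      · simp
      · exact (h k).le
    have hc₀ : ‖((X - C a) * P).coeff 0‖ = ‖a‖ * ‖P.coeff 0‖ := by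
      simp [sub_mul, mul_coeff_zero]
    rw [hc₀]
    refine ⟨mul_pos ha₀ h₀, fun k => ?_⟩
    have hc : ((X - C a) * P).coeff (k + 1) = P.coeff k - a * P.coeff (k + 1) := by
      simp [sub_mul, coeff_X_mul]
    have hmax : ‖P.coeff k - a * P.coeff (k + 1)‖ ≤
        max ‖P.coeff k‖ (‖a‖ * ‖P.coeff (k + 1)‖) := by
      simpa only [norm_mul, norm_neg, ← sub_eq_add_neg] using
        IsUltrametricDist.norm_add_le_max (P.coeff k) (-(a * P.coeff (k + 1)))
    rw [hc]
    refine (mul_le_mul_of_nonneg_right hmax (pow_pos hδ _).le).trans_lt ?_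
    rw [max_mul_of_nonneg _ _ (pow_pos hδ _).le]
    refine max_lt ?_ ?_
    · calc ‖P.coeff k‖ * δ ^ (k + 1) = δ * (‖P.coeff k‖ * δ ^ k) := by ring
        _ ≤ δ * ‖P.coeff 0‖ := mul_le_mul_of_nonneg_left (hle k) hδ.le
        _ < ‖a‖ * ‖P.coeff 0‖ := mul_lt_mul_of_pos_right ha h₀
    · rw [mul_assoc]
      exact mul_lt_mul_of_pos_left (h k) ha₀

/-- Over an algebraically closed ultrametric field, the coefficients of a polynomial without zeros
in the closed disk of radius `δ` about `0` are dominated there by the constant coefficient. -/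
theorem norm_coeff_mul_pow_lt_of_eval_ne_zero {F : Type*} [NormedField F] [IsUltrametricDist F]
    [IsAlgClosed F] {δ : ℝ} (hδ : 0 < δ) (g : F[X]) (hg : ∀ z, ‖z‖ ≤ δ → g.eval z ≠ 0) (k : ℕ) :
    ‖g.coeff (k + 1)‖ * δ ^ (k + 1) < ‖g.coeff 0‖ := by
  have hg₀ : g ≠ 0 := by
    rintro rfl
    exact hg 0 (by simpa using hδ.le) eval_zero
  have h := (norm_coeff_prod_X_sub_C_mul_pow_lt hδ g.roots fun a ha =>
    not_le.1 fun hle => hg a hle (isRoot_of_mem_roots ha)).2 k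
  have hlc : 0 < ‖g.leadingCoeff‖ := norm_pos_iff.2 (leadingCoeff_ne_zero.2 hg₀)
  rw [(IsAlgClosed.splits g).eq_prod_roots, coeff_C_mul, coeff_C_mul, norm_mul, norm_mul, mul_assoc]
  exact mul_lt_mul_of_pos_left h hlc

/-- **Proposition 3.2.** If `f'` has no zeros in `D̄_δ(z₀)`, then for the Taylor expansion
`f(z) = Σ c_l (z - z₀)^l` one has `|l|·|c_l|·δ^{l-1} < |c_1| = |f'(z₀)|` for `2 ≤ l ≤ d`,
where `|l|` is the `p`-adic absolute value of the integer `l`. -/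
theorem taylor_coeff_bound_of_derivative_ne_zero
    {p : ℕ} [Fact (Nat.Prime p)] {K : Type*} [NormedField K] [IsAlgClosed K]
    [CompleteSpace K] [IsUltrametricDist K] [Algebra ℚ_[p] K]
    (hext : ∀ q : ℚ_[p], ‖algebraMap ℚ_[p] K q‖ = ‖q‖)
    (d : ℕ) (hd : 2 ≤ d) (f : K[X]) (hdeg : f.natDegree = d)
    (z₀ : K) (δ : ℝ) (hδ : 0 < δ)
    (hder : ∀ z ∈ Metric.closedBall z₀ δ, (derivative f).eval z ≠ 0) :
    ∀ l : ℕ, 2 ≤ l → l ≤ d →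
      ‖(l : ℚ_[p])‖ * ‖(Polynomial.taylor z₀ f).coeff l‖ * δ ^ (l - 1) <
        ‖(Polynomial.taylor z₀ f).coeff 1‖ ∧
      ‖(Polynomial.taylor z₀ f).coeff 1‖ = ‖(derivative f).eval z₀‖ := by
  have hcoeff : ∀ k, (taylor z₀ (derivative f)).coeff k =
      (taylor z₀ f).coeff (k + 1) * ((k + 1 : ℕ) : K) := by
    intro k
    have : taylor z₀ (derivative f) = derivative (taylor z₀ f) := by
      simp [taylor_apply, derivative_comp]
    rw [this, coeff_derivative]
    push_cast
    rfl
  have h₁ : (taylor z₀ f).coeff 1 = (derivative f).eval z₀ := taylor_coeff_one z₀ f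
  intro l hl _
  refine ⟨?_, by rw [h₁]⟩
  obtain ⟨k, rfl⟩ : ∃ k, l = k + 2 := ⟨l - 2, by omega⟩
  have h := norm_coeff_mul_pow_lt_of_eval_ne_zero hδ (taylor z₀ (derivative f))
    (fun z hz => by
      rw [taylor_eval]
      exact hder _ (by simpa [dist_eq_norm] using hz)) k
  rw [hcoeff, hcoeff, norm_mul, ← map_natCast (algebraMap ℚ_[p] K), hext] at h
  rw [mul_comm ‖(taylor z₀ f).coeff (k + 1 + 1)‖] at h
  simp only [zero_add, Nat.cast_one, mul_one] at h
  exact h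
end
end
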